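/- Let g, p, h ∈ ℝ[x] with deg g ≥ 2 and deg h ≥ 1, let f(x,y) = g(x + p(y)) + h(y), let A, B ⊆ ℝ be finite sets, and let t ∈ (0,1] satisfy t|A| ≥ 1 and t|B| ≥ 1. Define Q = {(a_1, a_2, b_1, b_2) ∈ A² × B² : f(a_1, b_1) = f(a_2, b_2)} and R_t = {(α_1, α_2, a_1′, a_2′, b_1, b_2) ∈ (A+A)² × A² × B² : f(α_1 − a_1′, b_1) = f(α_2 − a_2′, b_2), the pair (α_1, α_2) is t-close in A + A, (a_1′, a_2′) is t-close in A, (b_1, b_2) is t-close in B, and (b_1, b_2) is not bad}. Then there exist constants c, c′ > 0, depending only on deg f, such that |R_t| ≥ c · t²|A|²|Q| − c′ · t|A|³|B|. -/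

import Mathlib

open Polynomial Finset Pointwise

/-- The (1-based) index of `x` in the increasing enumeration of the finite set `X ⊆ ℝ`. -/
noncomputable def idx (X : Finset ℝ) (x : ℝ) : ℕ :=
  (X.filter (fun y => y ≤ x)).card

/-- A pair `(x₁, x₂)` is `t`-close with respect to `X` if their indices differ by at most
`t|X|`. -/
def tClose (X : Finset ℝ) (t x₁ x₂ : ℝ) : Prop :=
  |(idx X x₁ : ℝ) - (idx X x₂ : ℝ)| ≤ t * (X.card : ℝ)

/-- A bivariate real polynomial is reducible if it is a product of two nonconstant
polynomials. -/
def RedBiv (F : MvPolynomial (Fin 2) ℝ) : Prop :=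
  ∃ F₁ F₂ : MvPolynomial (Fin 2) ℝ, F = F₁ * F₂ ∧ 1 ≤ F₁.totalDegree ∧ 1 ≤ F₂.totalDegree

/-- The bivariate polynomial `q(x) - q(y)`. -/
noncomputable def bivDiff (q : Polynomial ℝ) : MvPolynomial (Fin 2) ℝ :=
  Polynomial.aeval (MvPolynomial.X 0) q - Polynomial.aeval (MvPolynomial.X 1) q

/-- The pair `(b₁, b₂)` is bad if `g(x) - g(y) + h(b₁) - h(b₂)` or
`h(x) - h(y) + h(b₁) - h(b₂)` is reducible in `ℝ[x, y]`. -/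
def Bad (g h : Polynomial ℝ) (b₁ b₂ : ℝ) : Prop :=
  RedBiv (bivDiff g + MvPolynomial.C (h.eval b₁ - h.eval b₂)) ∨
  RedBiv (bivDiff h + MvPolynomial.C (h.eval b₁ - h.eval b₂))

/-- `f(x, y) = g(x + p(y)) + h(y)`. -/
noncomputable def fval (g p h : Polynomial ℝ) (x y : ℝ) : ℝ :=
  g.eval (x + p.eval y) + h.eval y

/-- The energy set `Q = {(a₁, a₂, b₁, b₂) ∈ A² × B² : f(a₁, b₁) = f(a₂, b₂)}`. -/
def Qset (g p h : Polynomial ℝ) (A B : Finset ℝ) : Set (ℝ × ℝ × ℝ × ℝ) :=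
  {q | ∃ a₁ a₂ b₁ b₂ : ℝ, q = (a₁, a₂, b₁, b₂) ∧ a₁ ∈ A ∧ a₂ ∈ A ∧ b₁ ∈ B ∧ b₂ ∈ B ∧
    fval g p h a₁ b₁ = fval g p h a₂ b₂}

/-- The proximity-restricted set `R_t`. -/
def Rtset (g p h : Polynomial ℝ) (A B : Finset ℝ) (t : ℝ) :
    Set (ℝ × ℝ × ℝ × ℝ × ℝ × ℝ) :=
  {r | ∃ α₁ α₂ a₁' a₂' b₁ b₂ : ℝ, r = (α₁, α₂, a₁', a₂', b₁, b₂) ∧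
    α₁ ∈ A + A ∧ α₂ ∈ A + A ∧ a₁' ∈ A ∧ a₂' ∈ A ∧ b₁ ∈ B ∧ b₂ ∈ B ∧
    fval g p h (α₁ - a₁') b₁ = fval g p h (α₂ - a₂') b₂ ∧
    tClose (A + A) t α₁ α₂ ∧ tClose A t a₁' a₂' ∧ tClose B t b₁ b₂ ∧
    ¬ Bad g h b₁ b₂}


/-! ### Part 1: bad pairs -/

section PartOne

local notation "R2" => MvPolynomial (Fin 2) ℝ

/-- Substitution `x_i ↦ x_i T`. -/
noncomputable def homT : R2 →ₐ[ℝ] Polynomial R2 :=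
  MvPolynomial.aeval (fun i => Polynomial.C (MvPolynomial.X i) * Polynomial.X)

lemma homT_eval_one (F : R2) : (homT F).eval 1 = F := by
  have : ((Polynomial.aeval (1 : R2)).restrictScalars ℝ).comp homT = AlgHom.id ℝ R2 := by
    apply MvPolynomial.algHom_ext
    intro i
    simp [homT]
  have h := DFunLike.congr_fun this F
  simpa [Polynomial.aeval_def] using h

lemma homT_map_eval (F : R2) :
    (homT F).map (MvPolynomial.constantCoeff)
      = Polynomial.C (MvPolynomial.constantCoeff F) := by
  induction F using MvPolynomial.induction_on with
  | C a => simp [homT]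
  | add p q hp hq => simp [hp, hq]
  | mul_X p i hp => simp [hp]; simp [homT]

lemma homT_eval_zero (F : R2) :
    (homT F).eval 0 = MvPolynomial.C (MvPolynomial.constantCoeff F) := by
  induction F using MvPolynomial.induction_on with
  | C a => simp [homT]
  | add p q hp hq => simp [hp, hq]
  | mul_X p i hp => simp [homT]

lemma homT_natDegree (F : R2) (hF : 1 ≤ F.totalDegree) : 1 ≤ (homT F).natDegree := by
  by_contra hlt
  have h0 : (homT F).natDegree = 0 := by omega
  obtain ⟨r, hr⟩ := Polynomial.natDegree_eq_zero.1 h0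
  have h1 := homT_eval_one F
  rw [← hr, Polynomial.eval_C] at h1
  have h2 := homT_eval_zero F
  rw [← hr, Polynomial.eval_C, h1] at h2
  rw [h2, MvPolynomial.totalDegree_C] at hF
  omega

/-- Formal descent: no relation `a F + b G = T^N`. -/
lemma no_rel (F G : Polynomial R2) (hcop : IsRelPrime (F.coeff 0) (G.coeff 0))
    (hF0 : MvPolynomial.constantCoeff (F.coeff 0) = 0)
    (hG0 : MvPolynomial.constantCoeff (G.coeff 0) = 0) (hG : G.coeff 0 ≠ 0)
    (N : ℕ) : ∀ a b : Polynomial R2, a * F + b * G ≠ Polynomial.X ^ N := by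
  induction N with
  | zero =>
    intro a b h
    have := congrArg (fun p => MvPolynomial.constantCoeff (p.coeff 0)) h
    simp [Polynomial.mul_coeff_zero, hF0, hG0] at this
  | succ N ih =>
    intro a b h
    have h0 := congrArg (fun p => p.coeff 0) h
    simp only [Polynomial.coeff_add, Polynomial.mul_coeff_zero] at h0
    rw [Polynomial.coeff_X_pow] at h0
    simp only [Nat.right_eq_add, Nat.add_eq_zero_iff, one_ne_zero, and_false, if_false] at h0
    have hdvd : G.coeff 0 ∣ a.coeff 0 := by
      apply hcop.symm.dvd_of_dvd_mul_right
      exact ⟨-b.coeff 0, by linear_combination h0⟩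
    obtain ⟨k, hk⟩ := hdvd
    have hb : b.coeff 0 = - k * F.coeff 0 := by
      apply mul_right_cancel₀ hG
      rw [hk] at h0
      linear_combination h0
    have ha' : Polynomial.X ∣ a - Polynomial.C k * G := by
      rw [Polynomial.X_dvd_iff]; simp [hk, mul_comm]
    have hb' : Polynomial.X ∣ b + Polynomial.C k * F := by
      rw [Polynomial.X_dvd_iff]; simp [hb]
    obtain ⟨a', ha'⟩ := ha'
    obtain ⟨b', hb'⟩ := hb'
    apply ih a' b'
    apply mul_left_cancel₀ (Polynomial.X_ne_zero (R := R2))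
    rw [pow_succ] at h
    linear_combination h - F * ha' - G * hb'

lemma relPrime_of_mul (n : ℕ) (hn : 1 ≤ n) (c : ℝ) (hc : c ≠ 0) (L M : R2)
    (h : L * M = MvPolynomial.C c * (MvPolynomial.X 0 ^ n - MvPolynomial.X 1 ^ n)) :
    IsRelPrime L M := by
  intro δ hL hM
  obtain ⟨l, rfl⟩ := hL
  obtain ⟨m, rfl⟩ := hM
  have hnr : (n : ℝ) ≠ 0 := by positivity
  have key : ∀ i : Fin 2, δ ∣ MvPolynomial.X i ^ (n-1) := by
    intro i
    have h1 := congrArg (MvPolynomial.pderiv i) h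
    have h3 : δ ∣ MvPolynomial.pderiv i (δ * l * (δ * m)) := by
      rw [show δ * l * (δ * m) = δ * (δ * (l * m)) by ring, MvPolynomial.pderiv_mul,
        MvPolynomial.pderiv_mul]
      exact ⟨MvPolynomial.pderiv i δ * (l * m) + (MvPolynomial.pderiv i δ * (l * m) +
        δ * MvPolynomial.pderiv i (l * m)), by ring⟩
    have hu : IsUnit (MvPolynomial.C (c * n) : R2) := by
      apply IsUnit.map; exact isUnit_iff_ne_zero.2 (mul_ne_zero hc hnr)
    rw [h1] at h3
    have h2 : δ ∣ MvPolynomial.C (c * n) * MvPolynomial.X i ^ (n-1) := by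
      fin_cases i
      · convert h3 using 1
        simp [MvPolynomial.pderiv_pow, MvPolynomial.pderiv_X, MvPolynomial.pderiv_mul]
        ring
      · rw [← dvd_neg]
        convert h3 using 1
        simp [MvPolynomial.pderiv_pow, MvPolynomial.pderiv_X, MvPolynomial.pderiv_mul]
        ring
    exact (hu.dvd_mul_left).1 h2
  have hXY : IsRelPrime (MvPolynomial.X 0 : R2) (MvPolynomial.X 1) := by
    rw [Irreducible.isRelPrime_iff_not_dvd MvPolynomial.X_prime.irreducible]
    rw [MvPolynomial.X_dvd_X]
    simp
  exact hXY.pow (key 0) (key 1)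

lemma coeff_homT_aeval (q : Polynomial ℝ) (i : Fin 2) (k : ℕ) :
    (homT (Polynomial.aeval (MvPolynomial.X i) q)).coeff k
      = MvPolynomial.C (q.coeff k) * MvPolynomial.X i ^ k := by
  induction q using Polynomial.induction_on' with
  | add p q hp hq => simp [hp, hq, add_mul]
  | monomial n a =>
    have : homT (Polynomial.aeval (MvPolynomial.X i) (Polynomial.monomial n a))
        = Polynomial.monomial n (MvPolynomial.C a * MvPolynomial.X i ^ n) := by
      simp [homT, mul_pow, ← Polynomial.C_mul_X_pow_eq_monomial, mul_assoc,
        IsScalarTower.algebraMap_apply ℝ R2 (Polynomial R2), MvPolynomial.algebraMap_eq]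
    rw [this, Polynomial.coeff_monomial, Polynomial.coeff_monomial]
    split_ifs with h
    · rw [h]
    · simp

lemma homT_C (c : ℝ) : homT (MvPolynomial.C c) = Polynomial.C (MvPolynomial.C c) := by
  simp [homT, IsScalarTower.algebraMap_apply ℝ R2 (Polynomial R2), MvPolynomial.algebraMap_eq]

lemma common_zero (q : Polynomial ℝ) (hq : 1 ≤ q.natDegree) (c : ℝ) (F G : R2)
    (hFG : bivDiff q + MvPolynomial.C c = F * G) (hF : 1 ≤ F.totalDegree)
    (hG : 1 ≤ G.totalDegree) :
    ∃ z : Fin 2 → ℂ, MvPolynomial.aeval z F = 0 ∧ MvPolynomial.aeval z G = 0 := by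
  by_contra! hno
  have hI : (Ideal.span {F, G} : Ideal R2) = ⊤ := by
    have h1 := MvPolynomial.vanishingIdeal_zeroLocus_eq_radical (K := ℂ)
      (Ideal.span {F, G} : Ideal R2)
    have h2 : MvPolynomial.zeroLocus ℂ (Ideal.span {F, G} : Ideal R2) = ∅ := by
      ext z
      simp only [MvPolynomial.zeroLocus_span, Set.mem_ofPred_eq, Set.mem_empty_iff_false,
        iff_false]
      intro h
      exact hno z (h F (by simp)) (h G (by simp))
    rw [h2, MvPolynomial.vanishingIdeal_empty] at h1
    exact Ideal.radical_eq_top.1 h1.symm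
  have h1 : (1 : R2) ∈ (Ideal.span {F, G} : Ideal R2) := by rw [hI]; trivial
  obtain ⟨a, b, hab⟩ := Ideal.mem_span_pair.1 h1
  set n := q.natDegree with hn
  have hlcq : q.coeff n ≠ 0 := by
    have : q ≠ 0 := by rintro rfl; simp at hn; omega
    simpa [hn] using this
  -- leading coefficients
  have hprodcoeff : ∀ k, 1 ≤ k → (homT F * homT G).coeff k = MvPolynomial.C (q.coeff k) *
      (MvPolynomial.X 0 ^ k - MvPolynomial.X 1 ^ k) := by
    intro k hk
    rw [← map_mul, ← hFG, bivDiff, map_add, map_sub, homT_C, Polynomial.coeff_add,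
      Polynomial.coeff_sub, coeff_homT_aeval, coeff_homT_aeval, Polynomial.coeff_C,
      if_neg (by omega)]
    ring
  have hXne : (MvPolynomial.X 0 ^ n - MvPolynomial.X 1 ^ n : R2) ≠ 0 := by
    intro h
    have := congrArg (MvPolynomial.eval (fun i : Fin 2 => if i = 0 then (1:ℝ) else 0)) h
    simp [show n ≠ 0 by omega] at this
  have htop : (homT F * homT G).coeff n ≠ 0 := by
    rw [hprodcoeff n hq]
    refine mul_ne_zero ?_ hXne
    simpa using hlcq
  have hdeg : (homT F * homT G).natDegree = n := by
    apply le_antisymm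
    · rw [Polynomial.natDegree_le_iff_coeff_eq_zero]
      intro k hk
      rw [hprodcoeff k (by omega), Polynomial.coeff_eq_zero_of_natDegree_lt hk]
      simp
    · exact Polynomial.le_natDegree_of_ne_zero htop
  have hlead : (homT F).leadingCoeff * (homT G).leadingCoeff = MvPolynomial.C (q.coeff n) *
      (MvPolynomial.X 0 ^ n - MvPolynomial.X 1 ^ n) := by
    rw [← Polynomial.leadingCoeff_mul, Polynomial.leadingCoeff, hdeg, hprodcoeff n hq]
  have hrel := relPrime_of_mul n hq _ hlcq _ _ hlead
  have hdF := homT_natDegree F hF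
  have hdG := homT_natDegree G hG
  set f := homT F
  set g := homT G
  have hcc : ∀ H : R2, 1 ≤ (homT H).natDegree →
      MvPolynomial.constantCoeff ((homT H).leadingCoeff) = 0 := by
    intro H hH
    have := congrArg (fun p => p.coeff (homT H).natDegree) (homT_map_eval H)
    simp only [Polynomial.coeff_map, Polynomial.coeff_C] at this
    rw [if_neg (by omega)] at this
    exact this
  have hg0 : g.leadingCoeff ≠ 0 := by
    intro h
    rw [Polynomial.leadingCoeff_eq_zero] at h
    rw [h] at hdG; simp at hdG
  have hr0 : ∀ p : Polynomial R2, (p.reflect p.natDegree).coeff 0 = p.leadingCoeff := by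
    intro p
    simp [Polynomial.coeff_reflect]
  set A := homT a
  set B := homT b
  have hAB : A * f + B * g = 1 := by
    rw [← map_mul, ← map_mul, ← map_add, hab, map_one]
  set s := A.natDegree + B.natDegree
  refine no_rel (f.reflect f.natDegree) (g.reflect g.natDegree) ?_ ?_ ?_ ?_
    (s + f.natDegree + g.natDegree) (A.reflect (s + g.natDegree)) (B.reflect (s + f.natDegree)) ?_
  · rw [hr0, hr0]; exact hrel
  · rw [hr0]; exact hcc F hdF
  · rw [hr0]; exact hcc G hdG
  · rw [hr0]; exact hg0
  · rw [← Polynomial.reflect_mul _ _ (by omega) le_rfl,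
      ← Polynomial.reflect_mul _ _ (by omega) le_rfl,
      show s + g.natDegree + f.natDegree = s + f.natDegree + g.natDegree by ring,
      ← Polynomial.reflect_add, hAB, Polynomial.reflect_one]

lemma pderiv_aeval_X (q : Polynomial ℝ) (i j : Fin 2) :
    MvPolynomial.pderiv i (Polynomial.aeval (MvPolynomial.X j : R2) q)
      = if i = j then Polynomial.aeval (MvPolynomial.X j : R2) (derivative q) else 0 := by
  rw [Derivation.map_aeval, MvPolynomial.pderiv_X]
  by_cases h : i = j
  · subst h; simp
  · simp [h, Pi.single_apply, Ne.symm h]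

lemma red_crit (q : Polynomial ℝ) (hq : 1 ≤ q.natDegree) (c : ℝ)
    (h : RedBiv (bivDiff q + MvPolynomial.C c)) :
    ∃ z w : ℂ, Polynomial.aeval z (derivative q) = 0 ∧ Polynomial.aeval w (derivative q) = 0 ∧
      (c : ℂ) = Polynomial.aeval w q - Polynomial.aeval z q := by
  obtain ⟨F, G, hFG, hF, hG⟩ := h
  obtain ⟨z, hzF, hzG⟩ := common_zero q hq c F G hFG hF hG
  have hd : ∀ i, MvPolynomial.aeval z (MvPolynomial.pderiv i (bivDiff q + MvPolynomial.C c)) = 0 := by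
    intro i
    rw [hFG, MvPolynomial.pderiv_mul]
    simp [hzF, hzG]
  have hev : ∀ (i : Fin 2) (r : Polynomial ℝ), MvPolynomial.aeval z
      (Polynomial.aeval (MvPolynomial.X i : R2) r) = Polynomial.aeval (z i) r := by
    intro i r
    rw [← Polynomial.aeval_algHom_apply, MvPolynomial.aeval_X]
  refine ⟨z 0, z 1, ?_, ?_, ?_⟩
  · have := hd 0
    simpa [bivDiff, pderiv_aeval_X, hev] using this
  · have := hd 1
    simpa [bivDiff, pderiv_aeval_X, hev] using this
  · have := congrArg (MvPolynomial.aeval z) hFG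
    simp [bivDiff, hev, hzF] at this
    linear_combination this

lemma red_finite (q : Polynomial ℝ) (d : ℕ) (hq : 1 ≤ q.natDegree) (hd : q.natDegree ≤ d) :
    ∃ S : Finset ℝ, S.card ≤ d ^ 2 ∧ ∀ c, RedBiv (bivDiff q + MvPolynomial.C c) → c ∈ S := by
  classical
  have hne : derivative q ≠ 0 := by
    intro h
    have := Polynomial.derivative_eq_zero.1 h
    omega
  set Z : Finset ℂ := ((derivative q).aroots ℂ).toFinset
  have hZ : Z.card ≤ d := by
    calc Z.card ≤ ((derivative q).aroots ℂ).card := Multiset.toFinset_card_le _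
      _ ≤ (derivative q).natDegree := by
        exact (Polynomial.card_roots' _).trans (Polynomial.natDegree_map_le)
      _ ≤ d := (Polynomial.natDegree_derivative_le q).trans (by omega)
  refine ⟨(Z ×ˢ Z).image (fun p => (Polynomial.aeval p.2 q - Polynomial.aeval p.1 q : ℂ).re),
    ?_, ?_⟩
  · refine Finset.card_image_le.trans ?_
    rw [Finset.card_product, sq]
    exact Nat.mul_le_mul hZ hZ
  · intro c hc
    obtain ⟨z, w, hz, hw, hcz⟩ := red_crit q hq c hc
    rw [Finset.mem_image]
    refine ⟨(z, w), ?_, ?_⟩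
    · simp only [Finset.mem_product, Z, Multiset.mem_toFinset, Polynomial.mem_aroots]
      exact ⟨⟨hne, hz⟩, ⟨hne, hw⟩⟩
    · simp only
      rw [← hcz, Complex.ofReal_re]

lemma bad_count (g h : Polynomial ℝ) (d : ℕ) (hg : 1 ≤ g.natDegree) (hgd : g.natDegree ≤ d)
    (hh : 1 ≤ h.natDegree) (hhd : h.natDegree ≤ d) (b₁ : ℝ) :
    ∃ S : Finset ℝ, S.card ≤ 2 * d ^ 3 ∧ ∀ b₂, Bad g h b₁ b₂ → b₂ ∈ S := by
  classical
  obtain ⟨S₁, hS₁, h₁⟩ := red_finite g d hg hgd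
  obtain ⟨S₂, hS₂, h₂⟩ := red_finite h d hh hhd
  have hdeg : ∀ r : ℝ, h - Polynomial.C r ≠ 0 := by
    intro r hr
    rw [sub_eq_zero] at hr
    rw [hr] at hh; simp at hh
  refine ⟨(S₁ ∪ S₂).biUnion (fun c => (h - Polynomial.C (h.eval b₁ - c)).roots.toFinset), ?_, ?_⟩
  · refine (Finset.card_biUnion_le_card_mul _ _ d ?_).trans ?_
    · intro c _
      refine (Multiset.toFinset_card_le _).trans ((Polynomial.card_roots' _).trans ?_)
      rw [Polynomial.natDegree_sub_C]; exact hhd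
    · calc (S₁ ∪ S₂).card * d ≤ (d^2 + d^2) * d :=
          Nat.mul_le_mul_right _ ((Finset.card_union_le _ _).trans (by omega))
        _ = 2 * d ^ 3 := by ring
  · intro b₂ hb
    rw [Finset.mem_biUnion]
    refine ⟨h.eval b₁ - h.eval b₂, ?_, ?_⟩
    · rw [Finset.mem_union]
      exact hb.imp (h₁ _) (h₂ _)
    · simp [hdeg]

end PartOne

/-! ### Part 2: counting cells -/

lemma thr_exists (c : ℝ → ℕ) (hc : Monotone c) : ∃ β : ℕ → ℝ, ∀ s x₁ x₂, c x₁ < s → s ≤ c x₂ →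
    x₁ ≤ β s ∧ β s ≤ x₂ := by
  refine ⟨fun s => sInf {x | s ≤ c x}, ?_⟩
  intro s x₁ x₂ h₁ h₂
  have hlb : x₁ ∈ lowerBounds {x | s ≤ c x} := by
    intro x (hx : s ≤ c x)
    by_contra hlt
    have := hc (le_of_lt (not_le.1 hlt))
    omega
  exact ⟨le_csInf ⟨x₂, h₂⟩ hlb, csInf_le ⟨x₁, hlb⟩ h₂⟩

lemma cell_const (c : ℝ → ℕ) (hc : Monotone c) (x₁ x₂ y : ℝ) (i : ℕ) (h₁ : c x₁ = i)
    (h₂ : c x₂ = i) (hy : y ∈ Set.uIcc x₁ x₂) : c y = i := by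
  rw [Set.mem_uIcc] at hy
  rcases hy with ⟨ha, hb⟩ | ⟨ha, hb⟩
  · have := hc ha; have := hc hb; omega
  · have := hc ha; have := hc hb; omega

/-- The cells hit by `Γ` are covered by a set of at most `n` cells. -/
def CellCov (cB cA cS : ℝ → ℕ) (Γ : Set (ℝ × ℝ)) (n : ℕ) : Prop :=
  ∃ E : Finset (ℕ × ℕ × ℕ), E.card ≤ n ∧ ∀ x y z, (x, y) ∈ Γ → (cB y, cA z, cS (x + z)) ∈ E

lemma cov_point (cB cA cS : ℝ → ℕ) (K : ℕ) (hA : ∀ x, cA x < K)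
    (hS : ∀ x, cS x < K) (Γ : Set (ℝ × ℝ)) (Y : Finset ℝ) (hΓ : ∀ x y, (x, y) ∈ Γ → y ∈ Y) :
    CellCov cB cA cS Γ (Y.card * K ^ 2) := by
  classical
  refine ⟨(Y ×ˢ (range K ×ˢ range K)).image (fun e => (cB e.1, e.2.1, e.2.2)), ?_, ?_⟩
  · refine Finset.card_image_le.trans ?_
    simp [Finset.card_product, sq]
  · intro x y z h
    rw [Finset.mem_image]
    exact ⟨(y, cA z, cS (x + z)), by simp [hΓ x y h, hA, hS], rfl⟩

lemma cov_biUnion {ι : Type*} [DecidableEq ι] (cB cA cS : ℝ → ℕ) (I : Finset ι)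
    (Γ : ι → Set (ℝ × ℝ)) (n : ℕ) (h : ∀ i ∈ I, CellCov cB cA cS (Γ i) n) :
    CellCov cB cA cS (⋃ i ∈ I, Γ i) (I.card * n) := by
  classical
  choose! E hE₁ hE₂ using h
  refine ⟨I.biUnion E, Finset.card_biUnion_le_card_mul _ _ _ hE₁, ?_⟩
  intro x y z hx
  simp only [Set.mem_iUnion] at hx
  obtain ⟨i, hi, hx⟩ := hx
  exact Finset.mem_biUnion.2 ⟨i, hi, hE₂ i hi x y z hx⟩

lemma cov_union (cB cA cS : ℝ → ℕ) (Γ₁ Γ₂ : Set (ℝ × ℝ)) (n₁ n₂ : ℕ)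
    (h₁ : CellCov cB cA cS Γ₁ n₁) (h₂ : CellCov cB cA cS Γ₂ n₂) :
    CellCov cB cA cS (Γ₁ ∪ Γ₂) (n₁ + n₂) := by
  classical
  obtain ⟨E₁, a₁, b₁⟩ := h₁
  obtain ⟨E₂, a₂, b₂⟩ := h₂
  refine ⟨E₁ ∪ E₂, (Finset.card_union_le _ _).trans (by omega), ?_⟩
  intro x y z h
  rw [Finset.mem_union]
  exact h.imp (b₁ x y z) (b₂ x y z)

lemma cov_mono (cB cA cS : ℝ → ℕ) (Γ₁ Γ₂ : Set (ℝ × ℝ)) (n₁ n₂ : ℕ) (hΓ : Γ₁ ⊆ Γ₂) (hn : n₂ ≤ n₁)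
    (h₂ : CellCov cB cA cS Γ₂ n₂) : CellCov cB cA cS Γ₁ n₁ := by
  obtain ⟨E₂, a₂, b₂⟩ := h₂
  exact ⟨E₂, a₂.trans hn, fun x y z h => b₂ x y z (hΓ h)⟩

lemma cov_vertical (cB cA cS : ℝ → ℕ) (K : ℕ) (hB : ∀ x, cB x < K) (hA : ∀ x, cA x < K)
    (hS : ∀ x, cS x < K) (mA : Monotone cA) (mS : Monotone cS)
    (Γ : Set (ℝ × ℝ)) (x₀ : ℝ) (hΓ : ∀ x y, (x, y) ∈ Γ → x = x₀) :
    CellCov cB cA cS Γ (2 * K ^ 2) := by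
  classical
  obtain ⟨β, hβ⟩ := thr_exists cS mS
  set P : ℕ → ℕ → ℕ → Prop := fun i j s => ∃ x y z, (x, y) ∈ Γ ∧ cB y = i ∧ cA z = j ∧
    cS (x + z) = s with hP
  set mn : ℕ → ℕ → ℕ := fun i j => sInf {s | P i j s} with hmn
  refine ⟨(range K ×ˢ range K).image (fun e => (e.1, e.2, mn e.1 e.2)) ∪
    (range K ×ˢ range K).image (fun e => (e.1, cA (β e.2 - x₀), e.2)), ?_, ?_⟩
  · refine (Finset.card_union_le _ _).trans ?_
    have h1 := Finset.card_image_le (s := range K ×ˢ range K)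
      (f := fun e => (e.1, e.2, mn e.1 e.2))
    have h2 := Finset.card_image_le (s := range K ×ˢ range K)
      (f := fun e => (e.1, cA (β e.2 - x₀), e.2))
    rw [Finset.card_product, Finset.card_range] at h1 h2
    nlinarith
  · intro x y z h
    have hmem : P (cB y) (cA z) (cS (x + z)) := ⟨x, y, z, h, rfl, rfl, rfl⟩
    have hle : mn (cB y) (cA z) ≤ cS (x + z) := Nat.sInf_le hmem
    have hmin : P (cB y) (cA z) (mn (cB y) (cA z)) := Nat.sInf_mem (s := {s | P (cB y) (cA z) s}) ⟨_, hmem⟩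
    rw [Finset.mem_union, Finset.mem_image, Finset.mem_image]
    rcases hle.eq_or_lt with he | hlt
    · left
      exact ⟨(cB y, cA z), by simp [hB, hA], by simp [he]⟩
    · right
      refine ⟨(cB y, cS (x + z)), by simp [hB, hS], ?_⟩
      obtain ⟨x', y', z', h', hy', hz', hs'⟩ := hmin
      have e1 := hΓ _ _ h; have e2 := hΓ _ _ h'
      obtain ⟨b1, b2⟩ := hβ (cS (x + z)) (x' + z') (x + z) (by omega) le_rfl
      have : cA (β (cS (x + z)) - x₀) = cA z := by
        apply cell_const cA mA z' z _ _ hz' rfl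
        rw [Set.mem_uIcc]; left; constructor <;> linarith
      simp [this]

lemma cov_ivp (cB cA cS : ℝ → ℕ) (K : ℕ) (hB : ∀ x, cB x < K) (hA : ∀ x, cA x < K)
    (hS : ∀ x, cS x < K) (mB : Monotone cB) (mA : Monotone cA) (mS : Monotone cS)
    (Γ : Set (ℝ × ℝ)) (N : ℕ)
    (hivp : ∀ x₁ y₁ x₂ y₂ x, (x₁, y₁) ∈ Γ → (x₂, y₂) ∈ Γ → x ∈ Set.uIcc x₁ x₂ →
      ∃ y ∈ Set.uIcc y₁ y₂, (x, y) ∈ Γ)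
    (hfib : ∀ x, ∃ Y : Finset ℝ, Y.card ≤ N ∧ ∀ y, (x, y) ∈ Γ → y ∈ Y) :
    CellCov cB cA cS Γ ((N + 2) * K ^ 2) := by
  classical
  obtain ⟨β, hβ⟩ := thr_exists cS mS
  obtain ⟨γ, hγ⟩ := thr_exists cA mA
  choose Y hY₁ hY₂ using hfib
  set P : ℕ → ℕ → ℕ → Prop := fun i j s => ∃ x y z, (x, y) ∈ Γ ∧ cB y = i ∧ cA z = j ∧
    cS (x + z) = s with hP
  set mn : ℕ → ℕ → ℕ := fun i j => sInf {s | P i j s} with hmn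
  set P' : ℕ → ℕ → ℕ → Prop := fun i s j => ∃ x y z, (x, y) ∈ Γ ∧ cB y = i ∧ cA z = j ∧
    x + z = β s with hP'
  set mn' : ℕ → ℕ → ℕ := fun i s => sInf {j | P' i s j} with hmn'
  refine ⟨(range K ×ˢ range K).image (fun e => (e.1, e.2, mn e.1 e.2)) ∪
    ((range K ×ˢ range K).image (fun e => (e.1, mn' e.1 e.2, e.2)) ∪
    (range K ×ˢ range K).biUnion (fun e => (Y (β e.2 - γ e.1)).image
      (fun y => (cB y, e.1, e.2)))), ?_, ?_⟩
  · have h1 := Finset.card_image_le (s := range K ×ˢ range K)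
      (f := fun e => (e.1, e.2, mn e.1 e.2))
    have h2 := Finset.card_image_le (s := range K ×ˢ range K)
      (f := fun e => (e.1, mn' e.1 e.2, e.2))
    have h3 := Finset.card_biUnion_le_card_mul (range K ×ˢ range K)
      (fun e => (Y (β e.2 - γ e.1)).image (fun y => (cB y, e.1, e.2))) N
      (fun e _ => Finset.card_image_le.trans (hY₁ _))
    rw [Finset.card_product, Finset.card_range] at h1 h2 h3
    refine (Finset.card_union_le _ _).trans ?_
    refine (Nat.add_le_add h1 ((Finset.card_union_le _ _).trans (Nat.add_le_add h2 h3))).trans ?_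
    apply le_of_eq; ring
  · intro x y z h
    have hmem : P (cB y) (cA z) (cS (x + z)) := ⟨x, y, z, h, rfl, rfl, rfl⟩
    have hle : mn (cB y) (cA z) ≤ cS (x + z) := Nat.sInf_le hmem
    have hmin : P (cB y) (cA z) (mn (cB y) (cA z)) := Nat.sInf_mem (s := {s | P (cB y) (cA z) s}) ⟨_, hmem⟩
    rw [Finset.mem_union, Finset.mem_union, Finset.mem_image, Finset.mem_image]
    rcases hle.eq_or_lt with he | hlt
    · left
      exact ⟨(cB y, cA z), by simp [hB, hA], by simp [he]⟩
    right
    have hcross : P' (cB y) (cS (x + z)) (cA z) := by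
      obtain ⟨x', y', z', h', hy', hz', hs'⟩ := hmin
      obtain ⟨b1, b2⟩ := hβ (cS (x + z)) (x' + z') (x + z) (by omega) le_rfl
      by_cases hc : β (cS (x + z)) ≤ x' + z
      · refine ⟨x', y', β (cS (x + z)) - x', h', hy', ?_, by ring⟩
        apply cell_const cA mA z' z _ _ hz' rfl
        rw [Set.mem_uIcc]; left; constructor <;> linarith
      · push Not at hc
        obtain ⟨w, hw, hw'⟩ := hivp x' y' x y (β (cS (x + z)) - z) h' h (by
          rw [Set.mem_uIcc]; left; constructor <;> linarith)
        exact ⟨_, w, z, hw', cell_const cB mB _ _ _ _ hy' rfl hw, rfl, by ring⟩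
    have hle' : mn' (cB y) (cS (x + z)) ≤ cA z := Nat.sInf_le hcross
    have hmin' : P' (cB y) (cS (x + z)) (mn' (cB y) (cS (x + z))) :=
      Nat.sInf_mem (s := {j | P' (cB y) (cS (x + z)) j}) ⟨_, hcross⟩
    rcases hle'.eq_or_lt with he | hlt'
    · left
      exact ⟨(cB y, cS (x + z)), by simp [hB, hS], by simp [he]⟩
    right
    rw [Finset.mem_biUnion]
    refine ⟨(cA z, cS (x + z)), by simp [hA, hS], ?_⟩
    obtain ⟨x₁, y₁, z₁, h₁, hy₁, hz₁, hs₁⟩ := hcross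
    obtain ⟨x₂, y₂, z₂, h₂, hy₂, hz₂, hs₂⟩ := hmin'
    obtain ⟨b1, b2⟩ := hγ (cA z) z₂ z₁ (by omega) hz₁.ge
    obtain ⟨w, hw, hw'⟩ := hivp x₁ y₁ x₂ y₂ (β (cS (x + z)) - γ (cA z)) h₁ h₂ (by
      rw [Set.mem_uIcc]; left; constructor <;> linarith)
    rw [Finset.mem_image]
    exact ⟨w, hY₂ _ _ hw', by simp [cell_const cB mB _ _ _ _ hy₁ hy₂ hw]⟩

/-! ### Part 3: the level curves of `f` -/

lemma mem_uIcc_of_inj (h : ℝ → ℝ) (hc : Continuous h) (a b y : ℝ)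
    (hi : Set.InjOn h (Set.uIcc a b)) (hy : y ∈ Set.uIcc a b) :
    h y ∈ Set.uIcc (h a) (h b) := by
  wlog hab : a ≤ b generalizing a b
  · rw [Set.uIcc_comm] at hi hy ⊢
    exact this b a hi hy (le_of_not_ge hab)
  rw [Set.uIcc_of_le hab] at hi hy
  rw [Set.mem_uIcc]
  have ha : a ∈ Set.Icc a b := ⟨le_rfl, hab⟩
  have hb : b ∈ Set.Icc a b := ⟨hab, le_rfl⟩
  rcases ContinuousOn.strictMonoOn_of_injOn_Icc' hab hc.continuousOn hi with hm | hm
  · left; exact ⟨hm.monotoneOn ha hy hy.1, hm.monotoneOn hy hb hy.2⟩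
  · right; exact ⟨hm.antitoneOn hy hb hy.2, hm.antitoneOn ha hy hy.1⟩

lemma ivp_curve (g p h : ℝ → ℝ) (hg : Continuous g) (hp : Continuous p) (hh : Continuous h)
    (U Y : Set ℝ) (oU : U.OrdConnected) (oY : Y.OrdConnected) (iU : Set.InjOn g U)
    (iY : Set.InjOn h Y) (v : ℝ) (x₁ y₁ x₂ y₂ x : ℝ)
    (hy₁ : y₁ ∈ Y) (hu₁ : x₁ + p y₁ ∈ U) (e₁ : g (x₁ + p y₁) + h y₁ = v)
    (hy₂ : y₂ ∈ Y) (hu₂ : x₂ + p y₂ ∈ U) (e₂ : g (x₂ + p y₂) + h y₂ = v)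
    (hx : x ∈ Set.uIcc x₁ x₂) :
    ∃ y ∈ Set.uIcc y₁ y₂, y ∈ Y ∧ x + p y ∈ U ∧ g (x + p y) + h y = v := by
  have hI : Set.uIcc (x₁ + p y₁) (x₂ + p y₂) ⊆ U := oU.uIcc_subset hu₁ hu₂
  have hJ : Set.uIcc y₁ y₂ ⊆ Y := oY.uIcc_subset hy₁ hy₂
  have hex : ∀ y : Set.uIcc y₁ y₂, ∃ u : Set.uIcc (x₁ + p y₁) (x₂ + p y₂),
      g u = v - h y := by
    intro y
    have h1 := mem_uIcc_of_inj h hh y₁ y₂ y (iY.mono hJ) y.2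
    have h2 : v - h y ∈ Set.uIcc (g (x₁ + p y₁)) (g (x₂ + p y₂)) := by
      rw [Set.mem_uIcc] at h1 ⊢
      rcases h1 with h1 | h1
      · right; constructor <;> linarith [h1.1, h1.2]
      · left; constructor <;> linarith [h1.1, h1.2]
    obtain ⟨u, hu, hu'⟩ := intermediate_value_uIcc hg.continuousOn h2
    exact ⟨⟨u, hu⟩, hu'⟩
  choose r hr using hex
  have hemb : Topology.IsClosedEmbedding
      (fun u : Set.uIcc (x₁ + p y₁) (x₂ + p y₂) => g u) := by
    have : CompactSpace (Set.uIcc (x₁ + p y₁) (x₂ + p y₂)) :=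
      isCompact_iff_compactSpace.1 isCompact_uIcc
    apply Continuous.isClosedEmbedding
    · fun_prop
    · intro a b hab
      exact Subtype.ext (iU (hI a.2) (hI b.2) hab)
  have hrc : Continuous r := by
    rw [hemb.isInducing.continuous_iff]
    have : (fun u : Set.uIcc (x₁ + p y₁) (x₂ + p y₂) => g u) ∘ r
        = fun y : Set.uIcc y₁ y₂ => v - h y := by
      funext y; exact hr y
    rw [this]; fun_prop
  have hφ : Continuous (fun y : Set.uIcc y₁ y₂ => (r y : ℝ) - p y) := by fun_prop
  have : PreconnectedSpace (Set.uIcc y₁ y₂) :=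
    Subtype.preconnectedSpace isPreconnected_uIcc
  set a₁ : Set.uIcc y₁ y₂ := ⟨y₁, Set.left_mem_uIcc⟩
  set a₂ : Set.uIcc y₁ y₂ := ⟨y₂, Set.right_mem_uIcc⟩
  have r₁ : (r a₁ : ℝ) = x₁ + p y₁ := by
    apply iU (hI (r a₁).2) hu₁
    rw [hr a₁]; linarith
  have r₂ : (r a₂ : ℝ) = x₂ + p y₂ := by
    apply iU (hI (r a₂).2) hu₂
    rw [hr a₂]; linarith
  have hmem : x ∈ Set.range (fun y : Set.uIcc y₁ y₂ => (r y : ℝ) - p y) := by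
    rw [Set.mem_uIcc] at hx
    have q₁ : (r a₁ : ℝ) - p a₁ = x₁ := by rw [r₁]; simp [a₁]
    have q₂ : (r a₂ : ℝ) - p a₂ = x₂ := by rw [r₂]; simp [a₂]
    rcases hx with hx | hx
    · exact intermediate_value_univ a₁ a₂ hφ (by simp only [q₁, q₂]; exact hx)
    · exact intermediate_value_univ a₂ a₁ hφ (by simp only [q₁, q₂]; exact hx)
  obtain ⟨y, hy⟩ := hmem
  simp only at hy
  have hxy : x + p y = r y := by linarith
  refine ⟨y, y.2, hJ y.2, ?_, ?_⟩
  · rw [hxy]; exact hI (r y).2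
  · rw [hxy, hr y]; ring

/-- Number of elements of `Z` below `u`. -/
noncomputable def rk (Z : Finset ℝ) (u : ℝ) : ℕ := (Z.filter (fun z => z < u)).card

/-- A component of the complement of `Z`. -/
def zcomp (Z : Finset ℝ) (m : ℕ) : Set ℝ := {u | u ∉ Z ∧ rk Z u = m}

lemma rk_mono (Z : Finset ℝ) : Monotone (rk Z) := by
  intro a b hab
  apply Finset.card_le_card
  intro z hz
  rw [Finset.mem_filter] at hz ⊢
  exact ⟨hz.1, hz.2.trans_le hab⟩

lemma rk_le (Z : Finset ℝ) (u : ℝ) : rk Z u ≤ Z.card := Finset.card_filter_le _ _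

lemma rk_eq_of_no (Z : Finset ℝ) (u₁ u₂ : ℝ) (h : ∀ z ∈ Z, z ∉ Set.uIcc u₁ u₂) :
    rk Z u₁ = rk Z u₂ := by
  unfold rk
  congr 1
  apply Finset.filter_congr
  intro z hz
  have := h z hz
  rw [Set.mem_uIcc] at this
  push Not at this
  constructor
  · intro h1
    by_contra h2
    have := this.2 (not_lt.1 h2)
    linarith
  · intro h1
    by_contra h2
    have := this.1 (not_lt.1 h2)
    linarith

lemma no_of_rk_eq (Z : Finset ℝ) (m : ℕ) (u₁ u₂ : ℝ) (h₁ : u₁ ∈ zcomp Z m) (h₂ : u₂ ∈ zcomp Z m)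
    (z : ℝ) (hz : z ∈ Z) (hz₁ : u₁ ≤ z) (hz₂ : z ≤ u₂) : False := by
  have hlt₂ : z < u₂ := lt_of_le_of_ne hz₂ (fun h => h₂.1 (h ▸ hz))
  have : rk Z u₁ < rk Z u₂ := by
    apply Finset.card_lt_card
    rw [Finset.ssubset_iff_of_subset]
    · exact ⟨z, by simp [hz, hlt₂], by simp [hz₁]⟩
    · intro w hw
      rw [Finset.mem_filter] at hw ⊢
      exact ⟨hw.1, by linarith [hw.2]⟩
  rw [h₁.2, h₂.2] at this
  omega

lemma comp_ord (Z : Finset ℝ) (m : ℕ) : (zcomp Z m).OrdConnected := by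
  constructor
  intro u₁ h₁ u₂ h₂ w hw
  refine ⟨fun hwz => no_of_rk_eq Z m u₁ u₂ h₁ h₂ w hwz hw.1 hw.2, ?_⟩
  have a := rk_mono Z hw.1
  have b := rk_mono Z hw.2
  rw [h₁.2] at a
  rw [h₂.2] at b
  omega

lemma comp_inj (q : Polynomial ℝ) (Z : Finset ℝ) (hZ : ∀ z, (derivative q).eval z = 0 → z ∈ Z)
    (m : ℕ) : Set.InjOn (fun x => q.eval x) (zcomp Z m) := by
  have key : ∀ a ∈ zcomp Z m, ∀ b ∈ zcomp Z m, a < b → q.eval a ≠ q.eval b := by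
    intro a ha b hb hab heq
    obtain ⟨c, hc, hc'⟩ := exists_hasDerivAt_eq_zero (f := fun x => q.eval x)
      (f' := fun x => (derivative q).eval x) hab q.continuous.continuousOn heq
      (fun x _ => q.hasDerivAt x)
    exact no_of_rk_eq Z m a b ha hb c (hZ c hc') hc.1.le hc.2.le
  intro a ha b hb hab
  rcases lt_trichotomy a b with h | h | h
  · exact absurd hab (key a ha b hb h)
  · exact h
  · exact absurd hab.symm (key b hb a ha h)

lemma crit_finset (q : Polynomial ℝ) (d : ℕ) (hq : 1 ≤ q.natDegree) (hd : q.natDegree ≤ d) :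
    ∃ Z : Finset ℝ, Z.card ≤ d ∧ ∀ z, z ∈ Z ↔ (derivative q).eval z = 0 := by
  classical
  have hne : derivative q ≠ 0 := by
    intro h
    have := Polynomial.derivative_eq_zero.1 h
    omega
  refine ⟨(derivative q).roots.toFinset, ?_, ?_⟩
  · refine (Multiset.toFinset_card_le _).trans ((Polynomial.card_roots' _).trans ?_)
    exact (Polynomial.natDegree_derivative_le q).trans (by omega)
  · intro z
    simp [hne]

lemma level_finset (q : Polynomial ℝ) (d : ℕ) (hq : 1 ≤ q.natDegree) (hd : q.natDegree ≤ d)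
    (w : ℝ) : ∃ Z : Finset ℝ, Z.card ≤ d ∧ ∀ z, q.eval z = w → z ∈ Z := by
  classical
  have hne : q - Polynomial.C w ≠ 0 := by
    intro h
    rw [sub_eq_zero] at h
    rw [h] at hq; simp at hq
  refine ⟨(q - Polynomial.C w).roots.toFinset, ?_, ?_⟩
  · refine (Multiset.toFinset_card_le _).trans ((Polynomial.card_roots' _).trans ?_)
    rw [Polynomial.natDegree_sub_C]; exact hd
  · intro z hz
    rw [Multiset.mem_toFinset, Polynomial.mem_roots hne]
    simp [hz]

lemma cov_class (g p h : Polynomial ℝ) (d : ℕ) (hgd : g.natDegree ≤ d) (hpd : p.natDegree ≤ d)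
    (hhd : h.natDegree ≤ d) (Z H : Finset ℝ) (hZ : ∀ z, z ∈ Z ↔ (derivative g).eval z = 0)
    (hH : ∀ z, z ∈ H ↔ (derivative h).eval z = 0) (m k : ℕ) (v : ℝ)
    (cB cA cS : ℝ → ℕ) (K : ℕ) (hB : ∀ x, cB x < K) (hA : ∀ x, cA x < K)
    (hS : ∀ x, cS x < K) (mB : Monotone cB) (mA : Monotone cA) (mS : Monotone cS) :
    CellCov cB cA cS {q | q.2 ∈ zcomp H k ∧ q.1 + p.eval q.2 ∈ zcomp Z m ∧
      g.eval (q.1 + p.eval q.2) + h.eval q.2 = v} ((d ^ 2 + d + 2) * K ^ 2) := by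
  classical
  set Γ : Set (ℝ × ℝ) := {q | q.2 ∈ zcomp H k ∧ q.1 + p.eval q.2 ∈ zcomp Z m ∧
      g.eval (q.1 + p.eval q.2) + h.eval q.2 = v} with hΓ
  have iU := comp_inj g Z (fun z => (hZ z).2) m
  have iY := comp_inj h H (fun z => (hH z).2) k
  set G : ℝ → Polynomial ℝ := fun x => g.comp (Polynomial.C x + p) + h - Polynomial.C v with hG
  have hGe : ∀ x y, (G x).eval y = g.eval (x + p.eval y) + h.eval y - v := by
    intro x y; simp [hG]
  by_cases hvert : ∃ x₀ y₀, (x₀, y₀) ∈ Γ ∧ G x₀ = 0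
  · obtain ⟨x₀, y₀, h₀, hG₀⟩ := hvert
    apply cov_mono cB cA cS Γ Γ _ (2 * K ^ 2) le_rfl (Nat.mul_le_mul_right _ (by omega))
    apply cov_vertical cB cA cS K hB hA hS mA mS Γ x₀
    have hval : ∀ y, g.eval (x₀ + p.eval y) + h.eval y = v := by
      intro y
      have := hGe x₀ y
      rw [hG₀, Polynomial.eval_zero] at this
      linarith
    have hder : ∀ y, (derivative g).eval (x₀ + p.eval y) * (derivative p).eval y
        + (derivative h).eval y = 0 := by
      intro y
      have := congrArg (fun q => (derivative q).eval y) hG₀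
      simp [hG, Polynomial.derivative_comp] at this
      linarith
    have hnZ : ∀ y ∈ zcomp H k, x₀ + p.eval y ∉ Z := by
      intro y hy hz
      have h1 := hder y
      rw [(hZ _).1 hz] at h1
      exact hy.1 ((hH y).2 (by linarith))
    have hU : ∀ y ∈ zcomp H k, x₀ + p.eval y ∈ zcomp Z m := by
      intro y hy
      refine ⟨hnZ y hy, ?_⟩
      have h2 := h₀.2.1.2
      simp only at h2
      rw [← h2]
      apply rk_eq_of_no
      intro z hz hzu
      have hcont : ContinuousOn (fun y => x₀ + p.eval y) (Set.uIcc y y₀) :=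
        (continuous_const.add p.continuous).continuousOn
      obtain ⟨w, hw, hw'⟩ := intermediate_value_uIcc hcont hzu
      simp only at hw'
      exact hnZ w ((comp_ord H k).uIcc_subset hy h₀.1 hw) (hw' ▸ hz)
    intro x y hxy
    have h3 : x + p.eval y = x₀ + p.eval y := by
      apply iU hxy.2.1 (hU y hxy.1)
      have h4 := hxy.2.2
      have h5 := hval y
      simp only at h4 ⊢
      linarith
    linarith
  · push Not at hvert
    apply cov_ivp cB cA cS K hB hA hS mB mA mS
    · intro x₁ y₁ x₂ y₂ x h₁ h₂ hx
      exact ivp_curve (fun x => g.eval x) (fun x => p.eval x) (fun x => h.eval x)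
        g.continuous p.continuous h.continuous _ _ (comp_ord Z m) (comp_ord H k) iU iY v
        x₁ y₁ x₂ y₂ x h₁.1 h₁.2.1 h₁.2.2 h₂.1 h₂.2.1 h₂.2.2 hx
    · intro x
      by_cases hx : G x = 0
      · refine ⟨∅, by simp, ?_⟩
        intro y hy
        exact absurd hx (hvert x y hy)
      · refine ⟨(G x).roots.toFinset, ?_, ?_⟩
        · refine (Multiset.toFinset_card_le _).trans ((Polynomial.card_roots' _).trans ?_)
          simp only [hG]
          rw [Polynomial.natDegree_sub_C]
          refine (Polynomial.natDegree_add_le _ _).trans (max_le ?_ (by nlinarith))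
          refine Polynomial.natDegree_comp_le.trans ?_
          rw [Polynomial.natDegree_C_add]
          calc _ ≤ d * d := Nat.mul_le_mul hgd hpd
            _ ≤ _ := by nlinarith
        · intro y hy
          rw [Multiset.mem_toFinset, Polynomial.mem_roots hx, Polynomial.IsRoot, hGe]
          have := hy.2.2
          simp only at this
          linarith

lemma cov_curve (g p h : Polynomial ℝ) (d : ℕ) (hgd : g.natDegree ≤ d) (hpd : p.natDegree ≤ d)
    (hhd : h.natDegree ≤ d) (hg : 1 ≤ g.natDegree) (hh : 1 ≤ h.natDegree) (v : ℝ)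
    (cB cA cS : ℝ → ℕ) (K : ℕ) (hB : ∀ x, cB x < K) (hA : ∀ x, cA x < K)
    (hS : ∀ x, cS x < K) (mB : Monotone cB) (mA : Monotone cA) (mS : Monotone cS) :
    CellCov cB cA cS {q | fval g p h q.1 q.2 = v}
      (((d + 1) ^ 2 * (d ^ 2 + d + 2) + (d + d ^ 2)) * K ^ 2) := by
  classical
  obtain ⟨Z, hZc, hZ⟩ := crit_finset g d hg hgd
  obtain ⟨H, hHc, hH⟩ := crit_finset h d hh hhd
  choose Y hYc hY using fun u => level_finset h d hh hhd (v - g.eval u)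
  have h1 := cov_biUnion cB cA cS (range (d + 1) ×ˢ range (d + 1))
    (fun e => {q | q.2 ∈ zcomp H e.2 ∧ q.1 + p.eval q.2 ∈ zcomp Z e.1 ∧
      g.eval (q.1 + p.eval q.2) + h.eval q.2 = v}) ((d ^ 2 + d + 2) * K ^ 2)
    (fun e _ => cov_class g p h d hgd hpd hhd Z H hZ hH e.1 e.2 v cB cA cS K hB hA hS mB mA mS)
  have h2 := cov_point cB cA cS K hA hS {q | q.2 ∈ H ∪ Z.biUnion Y} (H ∪ Z.biUnion Y)
    (fun x y h => h)
  refine cov_mono cB cA cS _ _ _ _ ?_ ?_ (cov_union cB cA cS _ _ _ _ h1 h2)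
  · rintro ⟨x, y⟩ hxy
    have hxy' : g.eval (x + p.eval y) + h.eval y = v := hxy
    by_cases hyH : y ∈ H
    · right
      exact Finset.mem_union_left _ hyH
    by_cases huZ : x + p.eval y ∈ Z
    · right
      apply Finset.mem_union_right
      rw [Finset.mem_biUnion]
      exact ⟨_, huZ, hY _ _ (by linarith)⟩
    left
    simp only [Set.mem_iUnion]
    refine ⟨(rk Z (x + p.eval y), rk H y), ?_, ⟨hyH, rfl⟩, ⟨huZ, rfl⟩, hxy'⟩
    have a := rk_le Z (x + p.eval y)
    have b := rk_le H y
    rw [Finset.mem_product, Finset.mem_range, Finset.mem_range]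
    constructor <;> simp only <;> omega
  · have h3 : (H ∪ Z.biUnion Y).card ≤ d + d ^ 2 := by
      refine (Finset.card_union_le _ _).trans (Nat.add_le_add hHc ?_)
      refine (Finset.card_biUnion_le_card_mul _ _ d (fun u _ => hYc u)).trans ?_
      rw [sq]; exact Nat.mul_le_mul_right _ hZc
    have h4 := Nat.mul_le_mul_right (K ^ 2) h3
    rw [Finset.card_product, Finset.card_range]
    calc _ ≤ (d + 1) * (d + 1) * ((d ^ 2 + d + 2) * K ^ 2) + (d + d ^ 2) * K ^ 2 :=
          Nat.add_le_add_left h4 _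
      _ = _ := by ring

/-! ### Part 4: the count -/

/-- Cell index. -/
noncomputable def cellIdx (X : Finset ℝ) (t : ℝ) (x : ℝ) : ℕ :=
  ⌊(idx X x : ℝ) / (t * (X.card : ℝ))⌋₊

lemma idx_mono (X : Finset ℝ) : Monotone (idx X) := by
  intro a b hab
  apply Finset.card_le_card
  intro z hz
  rw [Finset.mem_filter] at hz ⊢
  exact ⟨hz.1, hz.2.trans hab⟩

lemma idx_le (X : Finset ℝ) (x : ℝ) : idx X x ≤ X.card := Finset.card_filter_le _ _

lemma idx_injOn (X : Finset ℝ) : Set.InjOn (idx X) X := by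
  have key : ∀ a ∈ X, ∀ b ∈ X, a < b → idx X a < idx X b := by
    intro a ha b hb hab
    apply Finset.card_lt_card
    rw [Finset.ssubset_iff_of_subset]
    · exact ⟨b, by simp [hb], by simp [hab]⟩
    · intro z hz
      rw [Finset.mem_filter] at hz ⊢
      exact ⟨hz.1, hz.2.trans hab.le⟩
  intro a ha b hb hab
  rcases lt_trichotomy a b with h | h | h
  · have := key a ha b hb h; omega
  · exact h
  · have := key b hb a ha h; omega

lemma cellIdx_mono (X : Finset ℝ) (t : ℝ) (ht : 0 < t) : Monotone (cellIdx X t) := by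
  intro a b hab
  apply Nat.floor_le_floor
  apply div_le_div_of_nonneg_right _ (by positivity)
  exact_mod_cast idx_mono X hab

lemma cellIdx_lt (X : Finset ℝ) (t : ℝ) (ht : 0 < t) (x : ℝ) : cellIdx X t x < ⌊1 / t⌋₊ + 1 := by
  rw [Nat.lt_succ_iff]
  apply Nat.floor_le_floor
  have h1 : (idx X x : ℝ) ≤ X.card := by exact_mod_cast idx_le X x
  rcases Nat.eq_zero_or_pos X.card with h0 | h0
  · simp [h0, ht.le]
  · have : (0 : ℝ) < X.card := by exact_mod_cast h0
    rw [div_le_div_iff₀ (by positivity) ht]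
    nlinarith

lemma cellIdx_close (X : Finset ℝ) (t : ℝ) (ht : 0 < t) (x y : ℝ)
    (h : cellIdx X t x = cellIdx X t y) : tClose X t x y := by
  unfold tClose
  rcases Nat.eq_zero_or_pos X.card with h0 | h0
  · have h1 := idx_le X x
    have h2 := idx_le X y
    rw [h0] at h1 h2
    simp [Nat.le_zero.1 h1, Nat.le_zero.1 h2, h0]
  · have hpos : 0 < t * (X.card : ℝ) := by
      have : (0 : ℝ) < X.card := by exact_mod_cast h0
      positivity
    unfold cellIdx at h
    have a1 := Nat.floor_le (a := (idx X x : ℝ) / (t * (X.card : ℝ))) (by positivity)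
    have a2 := Nat.lt_floor_add_one ((idx X x : ℝ) / (t * (X.card : ℝ)))
    have b1 := Nat.floor_le (a := (idx X y : ℝ) / (t * (X.card : ℝ))) (by positivity)
    have b2 := Nat.lt_floor_add_one ((idx X y : ℝ) / (t * (X.card : ℝ)))
    rw [← h] at b1 b2
    have : |(idx X x : ℝ) / (t * (X.card : ℝ)) - (idx X y : ℝ) / (t * (X.card : ℝ))| ≤ 1 := by
      rw [abs_le]; constructor <;> linarith
    rw [← sub_div, abs_div, abs_of_pos hpos, div_le_one hpos] at this
    exact this

lemma close_count (X : Finset ℝ) (t : ℝ) (x : ℝ) (w : ℕ) (hw : t * (X.card : ℝ) < w + 1) :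
    ∃ S : Finset ℝ, S.card ≤ 2 * w + 1 ∧ ∀ y ∈ X, tClose X t x y → y ∈ S := by
  classical
  refine ⟨X.filter (fun y => idx X y ∈ Finset.Icc (idx X x - w) (idx X x + w)), ?_, ?_⟩
  · calc _ ≤ (Finset.Icc (idx X x - w) (idx X x + w)).card := by
          apply Finset.card_le_card_of_injOn (idx X)
          · intro y hy
            exact (Finset.mem_filter.1 hy).2
          · exact (idx_injOn X).mono (fun y hy => (Finset.mem_filter.1 hy).1)
      _ ≤ 2 * w + 1 := by rw [Nat.card_Icc]; omega
  · intro y hy hc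
    rw [Finset.mem_filter, Finset.mem_Icc]
    unfold tClose at hc
    rw [abs_le] at hc
    have h1 : (idx X x : ℝ) < idx X y + w + 1 := by linarith
    have h2 : (idx X y : ℝ) < idx X x + w + 1 := by linarith
    have h1' : idx X x < idx X y + w + 1 := by exact_mod_cast h1
    have h2' : idx X y < idx X x + w + 1 := by exact_mod_cast h2
    exact ⟨hy, by omega, by omega⟩

lemma cs_pairs {α β : Type*} [DecidableEq α] [DecidableEq β] (S : Finset α) (E : Finset β)
    (κ : α → β) (h : ∀ x ∈ S, κ x ∈ E) :
    S.card ^ 2 ≤ E.card * ((S ×ˢ S).filter (fun q => κ q.1 = κ q.2)).card := by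
  have h1 : S.card = ∑ e ∈ E, (S.filter (fun x => κ x = e)).card :=
    Finset.card_eq_sum_card_fiberwise h
  have h2 : ((S ×ˢ S).filter (fun q => κ q.1 = κ q.2)).card
      = ∑ e ∈ E, (S.filter (fun x => κ x = e)).card ^ 2 := by
    rw [Finset.card_eq_sum_card_fiberwise (f := fun q => κ q.1) (t := E)]
    · apply Finset.sum_congr rfl
      intro e _
      rw [sq, ← Finset.card_product]
      congr 1
      ext ⟨x, y⟩
      simp only [Finset.mem_filter, Finset.mem_product]
      constructor
      · rintro ⟨⟨⟨hx, hy⟩, hxy⟩, he⟩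
        exact ⟨⟨hx, he⟩, hy, hxy ▸ he⟩
      · rintro ⟨⟨hx, he⟩, hy, he'⟩
        exact ⟨⟨⟨hx, hy⟩, he.trans he'.symm⟩, he⟩
    · intro q hq
      have hq' := Finset.mem_filter.1 hq
      exact h _ (Finset.mem_product.1 hq'.1).1
  rw [h2]
  conv_lhs => rw [h1]
  exact sq_sum_le_card_mul_sum_sq

lemma pairs_le {α γ β : Type*} [DecidableEq α] [DecidableEq β] [DecidableEq γ] (T : Finset α)
    (val : α → γ) (κ : α → β) (M : ℕ)
    (h : ∀ v, ∃ E : Finset β, E.card ≤ M ∧ ∀ x ∈ T, val x = v → κ x ∈ E) :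
    ((T ×ˢ T).filter (fun q => val q.1 = val q.2)).card ≤
      M * ((T ×ˢ T).filter (fun q => val q.1 = val q.2 ∧ κ q.1 = κ q.2)).card := by
  rw [Finset.card_eq_sum_card_fiberwise (f := fun q => val q.1) (t := T.image val)
    (s := (T ×ˢ T).filter (fun q => val q.1 = val q.2)),
    Finset.card_eq_sum_card_fiberwise (f := fun q => val q.1) (t := T.image val)
    (s := (T ×ˢ T).filter (fun q => val q.1 = val q.2 ∧ κ q.1 = κ q.2)), Finset.mul_sum]
  · apply Finset.sum_le_sum
    intro v _
    obtain ⟨E, hE, hE'⟩ := h v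
    have h1 := cs_pairs (T.filter (fun x => val x = v)) E κ
      (fun x hx => hE' x (Finset.mem_filter.1 hx).1 (Finset.mem_filter.1 hx).2)
    have h2 : (((T ×ˢ T).filter (fun q => val q.1 = val q.2)).filter
        (fun q => val q.1 = v)).card ≤ (T.filter (fun x => val x = v)).card ^ 2 := by
      rw [sq, ← Finset.card_product]
      apply Finset.card_le_card
      rintro ⟨x, y⟩ hxy
      simp only [Finset.mem_filter, Finset.mem_product] at hxy ⊢
      obtain ⟨⟨⟨hx, hy⟩, hxy⟩, he⟩ := hxy
      exact ⟨⟨hx, he⟩, hy, hxy ▸ he⟩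
    refine h2.trans (h1.trans ?_)
    refine Nat.mul_le_mul hE (Finset.card_le_card ?_)
    rintro ⟨x, y⟩ hxy
    simp only [Finset.mem_filter, Finset.mem_product] at hxy ⊢
    obtain ⟨⟨⟨hx, hxv⟩, hy, hyv⟩, he⟩ := hxy
    exact ⟨⟨⟨hx, hy⟩, hxv.trans hyv.symm, he⟩, hxv⟩
  · intro q hq
    exact Finset.mem_image_of_mem _ (Finset.mem_product.1 (Finset.mem_filter.1 hq).1).1
  · intro q hq
    exact Finset.mem_image_of_mem _ (Finset.mem_product.1 (Finset.mem_filter.1 hq).1).1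

/-- Value of a triple `(a, z, b)`. -/
noncomputable def tval (g p h : Polynomial ℝ) (τ : ℝ × ℝ × ℝ) : ℝ := fval g p h τ.1 τ.2.2

lemma Q_le (g p h : Polynomial ℝ) (A B : Finset ℝ) [DecidableEq ℝ] :
    A.card ^ 2 * (Qset g p h A B).ncard ≤
      ((((A ×ˢ A ×ˢ B) ×ˢ (A ×ˢ A ×ˢ B))).filter
        (fun q => tval g p h q.1 = tval g p h q.2)).card := by
  set QF : Finset (ℝ × ℝ × ℝ × ℝ) := (A ×ˢ A ×ˢ B ×ˢ B).filter
    (fun q => fval g p h q.1 q.2.2.1 = fval g p h q.2.1 q.2.2.2) with hQF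
  have hQ : Qset g p h A B = (QF : Set (ℝ × ℝ × ℝ × ℝ)) := by
    ext ⟨a₁, a₂, b₁, b₂⟩
    simp only [Qset, hQF, Finset.coe_filter, Finset.mem_product]
    constructor
    · rintro ⟨_, _, _, _, he, h1, h2, h3, h4, h5⟩
      simp only [Prod.mk.injEq] at he
      obtain ⟨rfl, rfl, rfl, rfl⟩ := he
      exact ⟨⟨h1, h2, h3, h4⟩, h5⟩
    · rintro ⟨⟨h1, h2, h3, h4⟩, h5⟩
      exact ⟨_, _, _, _, rfl, h1, h2, h3, h4, h5⟩
  rw [hQ, Set.ncard_coe_finset, sq, ← Finset.card_product, ← Finset.card_product]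
  apply Finset.card_le_card_of_injOn
    (fun e => ((e.2.1, e.1.1, e.2.2.2.1), (e.2.2.1, e.1.2, e.2.2.2.2)))
  · rintro ⟨⟨x, y⟩, a₁, a₂, b₁, b₂⟩ he
    simp only [hQF, Finset.coe_product, Finset.coe_filter, Set.mem_prod, Finset.mem_coe,
      Set.mem_ofPred_eq, Finset.mem_product] at he
    refine Finset.mem_coe.2 (Finset.mem_filter.2 ⟨?_, he.2.2⟩)
    simp only [Finset.mem_product]
    exact ⟨⟨he.2.1.1, he.1.1, he.2.1.2.2.1⟩, he.2.1.2.1, he.1.2, he.2.1.2.2.2⟩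
  · rintro ⟨⟨x, y⟩, a₁, a₂, b₁, b₂⟩ _ ⟨⟨x', y'⟩, a₁', a₂', b₁', b₂'⟩ _ heq
    simp only [Prod.mk.injEq] at heq ⊢
    tauto

lemma R_finite (g p h : Polynomial ℝ) (A B : Finset ℝ) (t : ℝ) :
    (Rtset g p h A B t).Finite := by
  classical
  apply Set.Finite.subset
    (Finset.finite_toSet ((A + A) ×ˢ (A + A) ×ˢ A ×ˢ A ×ˢ B ×ˢ B))
  rintro _ ⟨α₁, α₂, a₁, a₂, b₁, b₂, rfl, h1, h2, h3, h4, h5, h6, _⟩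
  simp only [Finset.mem_coe, Finset.mem_product]
  exact ⟨h1, h2, h3, h4, h5, h6⟩

lemma good_le (g p h : Polynomial ℝ) (A B : Finset ℝ) (t : ℝ)
    (W : Finset ((ℝ × ℝ × ℝ) × (ℝ × ℝ × ℝ)))
    (hW : ∀ a₁ z₁ b₁ a₂ z₂ b₂, ((a₁, z₁, b₁), (a₂, z₂, b₂)) ∈ W →
      a₁ ∈ A ∧ z₁ ∈ A ∧ b₁ ∈ B ∧ a₂ ∈ A ∧ z₂ ∈ A ∧ b₂ ∈ B ∧
      fval g p h a₁ b₁ = fval g p h a₂ b₂ ∧ tClose (A + A) t (a₁ + z₁) (a₂ + z₂) ∧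
      tClose A t z₁ z₂ ∧ tClose B t b₁ b₂ ∧ ¬ Bad g h b₁ b₂) :
    W.card ≤ (Rtset g p h A B t).ncard := by
  classical
  rw [← Set.ncard_coe_finset]
  refine Set.ncard_le_ncard_of_injOn
    (fun e => (e.1.1 + e.1.2.1, e.2.1 + e.2.2.1, e.1.2.1, e.2.2.1, e.1.2.2, e.2.2.2))
    ?_ ?_ (R_finite g p h A B t)
  · rintro ⟨⟨a₁, z₁, b₁⟩, ⟨a₂, z₂, b₂⟩⟩ he
    obtain ⟨h1, h2, h3, h4, h5, h6, h7, h8, h9, h10, h11⟩ := hW _ _ _ _ _ _ he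
    refine ⟨_, _, _, _, _, _, rfl, Finset.add_mem_add h1 h2, Finset.add_mem_add h4 h5, h2, h5,
      h3, h6, ?_, h8, h9, h10, h11⟩
    simpa using h7
  · rintro ⟨⟨a₁, z₁, b₁⟩, ⟨a₂, z₂, b₂⟩⟩ _ ⟨⟨a₁', z₁', b₁'⟩, ⟨a₂', z₂', b₂'⟩⟩ _ heq
    simp only [Prod.mk.injEq] at heq ⊢
    obtain ⟨e1, e2, rfl, rfl, rfl, rfl⟩ := heq
    refine ⟨⟨by linarith, rfl, rfl⟩, by linarith, rfl, rfl⟩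

lemma bad_le (g p h : Polynomial ℝ) (d : ℕ) (hg : 1 ≤ g.natDegree) (hgd : g.natDegree ≤ d)
    (hh : 1 ≤ h.natDegree) (hhd : h.natDegree ≤ d) (A B : Finset ℝ) (t : ℝ) (w : ℕ)
    (hw : t * (A.card : ℝ) < w + 1)
    (W : Finset ((ℝ × ℝ × ℝ) × (ℝ × ℝ × ℝ)))
    (hW : ∀ a₁ z₁ b₁ a₂ z₂ b₂, ((a₁, z₁, b₁), (a₂, z₂, b₂)) ∈ W →
      z₁ ∈ A ∧ b₁ ∈ B ∧ a₂ ∈ A ∧ z₂ ∈ A ∧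
      fval g p h a₁ b₁ = fval g p h a₂ b₂ ∧ tClose A t z₁ z₂ ∧ Bad g h b₁ b₂) :
    W.card ≤ (A.card * (A.card * B.card)) * ((2 * d ^ 3 * (2 * w + 1)) * d) := by
  classical
  choose S hSc hS using bad_count g h d hg hgd hh hhd
  choose Cl hClc hCl using fun x => close_count A t x w hw
  choose L hLc hL using level_finset g d hg hgd
  have hsub : W ⊆ (A ×ˢ A ×ˢ B).biUnion (fun e => ((S e.2.2) ×ˢ (Cl e.1)).biUnion (fun f =>
      (L (fval g p h e.2.1 f.1 - h.eval e.2.2)).image (fun u =>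
        ((u - p.eval e.2.2, e.1, e.2.2), (e.2.1, f.2, f.1))))) := by
    rintro ⟨⟨a₁, z₁, b₁⟩, ⟨a₂, z₂, b₂⟩⟩ he
    obtain ⟨h1, h2, h3, h4, h5, h6, h7⟩ := hW _ _ _ _ _ _ he
    rw [Finset.mem_biUnion]
    refine ⟨(z₁, a₂, b₁), by simp [h1, h2, h3], ?_⟩
    rw [Finset.mem_biUnion]
    refine ⟨(b₂, z₂), Finset.mem_product.2 ⟨hS _ _ h7, hCl _ _ h4 h6⟩, ?_⟩
    rw [Finset.mem_image]
    refine ⟨a₁ + p.eval b₁, hL _ _ ?_, by simp⟩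
    simp only
    rw [← h5, fval]; ring
  refine (Finset.card_le_card hsub).trans ?_
  refine (Finset.card_biUnion_le_card_mul _ _ ((2 * d ^ 3 * (2 * w + 1)) * d) ?_).trans ?_
  · intro e _
    refine (Finset.card_biUnion_le_card_mul _ _ d ?_).trans ?_
    · intro f _
      exact Finset.card_image_le.trans (hLc _)
    · apply Nat.mul_le_mul_right
      rw [Finset.card_product]
      exact Nat.mul_le_mul (hSc _) (hClc _)
  · rw [Finset.card_product, Finset.card_product]

lemma main_nat (g p h : Polynomial ℝ) (d : ℕ) (hgd : g.natDegree ≤ d) (hpd : p.natDegree ≤ d)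
    (hhd : h.natDegree ≤ d) (hg : 1 ≤ g.natDegree) (hh : 1 ≤ h.natDegree)
    (A B : Finset ℝ) (t : ℝ) (ht : 0 < t) (w : ℕ) (hw : t * (A.card : ℝ) < w + 1) :
    A.card ^ 2 * (Qset g p h A B).ncard ≤
      (((d + 1) ^ 2 * (d ^ 2 + d + 2) + (d + d ^ 2)) * (⌊1 / t⌋₊ + 1) ^ 2) *
      ((Rtset g p h A B t).ncard +
        (A.card * (A.card * B.card)) * ((2 * d ^ 3 * (2 * w + 1)) * d)) := by
  classical
  set κ : ℝ × ℝ × ℝ → ℕ × ℕ × ℕ := fun τ =>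
    (cellIdx B t τ.2.2, cellIdx A t τ.2.1, cellIdx (A + A) t (τ.1 + τ.2.1)) with hκ
  have h1 := Q_le g p h A B
  have h2 := pairs_le (A ×ˢ A ×ˢ B) (tval g p h) κ
    (((d + 1) ^ 2 * (d ^ 2 + d + 2) + (d + d ^ 2)) * (⌊1 / t⌋₊ + 1) ^ 2) (by
      intro v
      obtain ⟨E, hE, hE'⟩ := cov_curve g p h d hgd hpd hhd hg hh v (cellIdx B t) (cellIdx A t)
        (cellIdx (A + A) t) (⌊1 / t⌋₊ + 1) (cellIdx_lt B t ht) (cellIdx_lt A t ht)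
        (cellIdx_lt (A + A) t ht) (cellIdx_mono B t ht) (cellIdx_mono A t ht)
        (cellIdx_mono (A + A) t ht)
      refine ⟨E, hE, ?_⟩
      rintro ⟨a, z, b⟩ _ hv
      exact hE' a b z hv)
  refine h1.trans (h2.trans (Nat.mul_le_mul_left _ ?_))
  set W := ((A ×ˢ A ×ˢ B) ×ˢ (A ×ˢ A ×ˢ B)).filter
    (fun q => tval g p h q.1 = tval g p h q.2 ∧ κ q.1 = κ q.2) with hWdef
  have hWm : ∀ a₁ z₁ b₁ a₂ z₂ b₂, ((a₁, z₁, b₁), (a₂, z₂, b₂)) ∈ W →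
      a₁ ∈ A ∧ z₁ ∈ A ∧ b₁ ∈ B ∧ a₂ ∈ A ∧ z₂ ∈ A ∧ b₂ ∈ B ∧
      fval g p h a₁ b₁ = fval g p h a₂ b₂ ∧ tClose (A + A) t (a₁ + z₁) (a₂ + z₂) ∧
      tClose A t z₁ z₂ ∧ tClose B t b₁ b₂ := by
    intro a₁ z₁ b₁ a₂ z₂ b₂ hm
    simp only [hWdef, Finset.mem_filter, Finset.mem_product, hκ, Prod.mk.injEq, tval] at hm
    obtain ⟨⟨⟨m1, m2, m3⟩, m4, m5, m6⟩, m7, m8, m9, m10⟩ := hm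
    exact ⟨m1, m2, m3, m4, m5, m6, m7, cellIdx_close _ t ht _ _ m10,
      cellIdx_close _ t ht _ _ m9, cellIdx_close _ t ht _ _ m8⟩
  rw [← Finset.card_filter_add_card_filter_not (s := W) (fun q => ¬ Bad g h q.1.2.2 q.2.2.2)]
  apply Nat.add_le_add
  · apply good_le
    intro a₁ z₁ b₁ a₂ z₂ b₂ hm
    rw [Finset.mem_filter] at hm
    obtain ⟨m1, m2, m3, m4, m5, m6, m7, m8, m9, m10⟩ := hWm _ _ _ _ _ _ hm.1
    exact ⟨m1, m2, m3, m4, m5, m6, m7, m8, m9, m10, hm.2⟩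
  · apply bad_le g p h d hg hgd hh hhd A B t w hw
    intro a₁ z₁ b₁ a₂ z₂ b₂ hm
    rw [Finset.mem_filter] at hm
    obtain ⟨m1, m2, m3, m4, m5, m6, m7, m8, m9, m10⟩ := hWm _ _ _ _ _ _ hm.1
    exact ⟨m2, m3, m4, m5, m7, m9, not_not.1 hm.2⟩

theorem stmt8 (d : ℕ) :
    ∃ c c' : ℝ, 0 < c ∧ 0 < c' ∧
      ∀ g p h : Polynomial ℝ,
        g.natDegree ≤ d → p.natDegree ≤ d → h.natDegree ≤ d →
        2 ≤ g.natDegree → 1 ≤ h.natDegree →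
        ∀ (A B : Finset ℝ) (t : ℝ), 0 < t → t ≤ 1 →
          1 ≤ t * (A.card : ℝ) → 1 ≤ t * (B.card : ℝ) →
          c * t ^ 2 * (A.card : ℝ) ^ 2 * ((Qset g p h A B).ncard : ℝ)
              - c' * t * (A.card : ℝ) ^ 3 * (B.card : ℝ)
            ≤ ((Rtset g p h A B t).ncard : ℝ) := by
  set C : ℝ := (d + 1) ^ 2 * (d ^ 2 + d + 2) + (d + d ^ 2) with hC
  have hCpos : 0 < C := by positivity
  refine ⟨1 / (4 * C), 6 * d ^ 4 + 1, by positivity, by positivity, ?_⟩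
  intro g p h hgd hpd hhd hg hh A B t ht ht1 hA _
  set w := ⌊t * (A.card : ℝ)⌋₊ with hw
  have hw1 : t * (A.card : ℝ) < w + 1 := Nat.lt_floor_add_one _
  have hw2 : (w : ℝ) ≤ t * (A.card : ℝ) := Nat.floor_le (by positivity)
  have hmain := main_nat g p h d hgd hpd hhd (by omega) hh A B t ht w hw1
  have hmain' : (A.card : ℝ) ^ 2 * ((Qset g p h A B).ncard : ℝ) ≤
      (C * ((⌊1 / t⌋₊ : ℝ) + 1) ^ 2) * (((Rtset g p h A B t).ncard : ℝ) +
        ((A.card : ℝ) * (A.card * B.card)) * ((2 * d ^ 3 * (2 * w + 1)) * d)) := by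
    rw [hC]; exact_mod_cast hmain
  set k : ℝ := (⌊1 / t⌋₊ : ℝ) + 1 with hk
  have hk0 : 0 ≤ k := by positivity
  have hkt : t * k ≤ 2 := by
    have h1 : (⌊1 / t⌋₊ : ℝ) ≤ 1 / t := Nat.floor_le (by positivity)
    have h2 : t * (⌊1 / t⌋₊ : ℝ) ≤ 1 := by
      calc t * (⌊1 / t⌋₊ : ℝ) ≤ t * (1 / t) := by gcongr
        _ = 1 := by field_simp
    rw [hk]; linarith
  have hkt2 : t ^ 2 * k ^ 2 ≤ 4 := by
    have h0 : 0 ≤ t * k := by positivity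
    nlinarith
  set R : ℝ := ((Rtset g p h A B t).ncard : ℝ) with hR
  set a : ℝ := (A.card : ℝ) with ha
  set b : ℝ := (B.card : ℝ) with hb
  set q : ℝ := ((Qset g p h A B).ncard : ℝ) with hq
  have ha0 : 0 ≤ a := by positivity
  have hb0 : 0 ≤ b := by positivity
  have hR0 : 0 ≤ R := by positivity
  have hbad : a * (a * b) * ((2 * d ^ 3 * (2 * w + 1)) * d) ≤ (6 * d ^ 4 + 1) * t * a ^ 3 * b := by
    have h3 : (2 * (w : ℝ) + 1) ≤ 3 * (t * a) := by linarith
    calc a * (a * b) * ((2 * d ^ 3 * (2 * w + 1)) * d)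
        ≤ a * (a * b) * ((2 * d ^ 3 * (3 * (t * a))) * d) := by gcongr
      _ = (6 * d ^ 4) * t * a ^ 3 * b := by ring
      _ ≤ (6 * d ^ 4 + 1) * t * a ^ 3 * b := by gcongr; linarith
  set D := a * (a * b) * ((2 * (d : ℝ) ^ 3 * (2 * w + 1)) * d) with hD
  have hD0 : 0 ≤ D := by positivity
  have hfin : 1 / (4 * C) * t ^ 2 * a ^ 2 * q ≤ R + D := by
    calc 1 / (4 * C) * t ^ 2 * a ^ 2 * q = 1 / (4 * C) * t ^ 2 * (a ^ 2 * q) := by ring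
      _ ≤ 1 / (4 * C) * t ^ 2 * (C * k ^ 2 * (R + D)) := by gcongr
      _ = (t ^ 2 * k ^ 2) / 4 * (R + D) := by field_simp
      _ ≤ 1 * (R + D) := by
        apply mul_le_mul_of_nonneg_right _ (by positivity)
        linarith
      _ = R + D := one_mul _
  linarith
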